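/- Let S/R be a G-Galois extension with G = ⟨σ⟩ of prime order p, where R is a ℤ[ρ]-algebra (ρ a primitive p-th root of unity, η = ρ-1). Let S_ρ = {s ∈ S : σ(s) = ρs}. Then S_ρ is a rank-one projective R-module whose class in Pic(R) has order dividing p, and the multiplication map of S induces an isomorphism S_ρ^{⊗p} ≅ R. -/

import Mathlib

open scoped TensorProduct

/-- The canonical map `S ⊗[R] S → ∏_{g ∈ G} S`, `s ⊗ t ↦ (s · g(t))_g`, whose
bijectivity (together with finiteness and projectivity of `S` over `R`) defines a
`G`-Galois extension of commutative rings. -/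
noncomputable def galMap (R S G : Type*) [CommRing R] [CommRing S] [Algebra R S]
    [Group G] (act : G →* (S ≃ₐ[R] S)) : S ⊗[R] S →ₗ[R] (G → S) :=
  TensorProduct.lift
    (LinearMap.mk₂ R (fun s t g => s * act g t)
      (fun s s' t => by funext g; simp [add_mul])
      (fun c s t => by funext g; simp [smul_mul_assoc])
      (fun s t t' => by funext g; simp [mul_add])
      (fun c s t => by funext g; simp [mul_smul_comm]))

/-- `S/R` is a `G`-Galois extension of commutative rings. -/
def IsGaloisExt (R S G : Type*) [CommRing R] [CommRing S] [Algebra R S]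
    [Group G] (act : G →* (S ≃ₐ[R] S)) : Prop :=
  Module.Finite R S ∧ Module.Projective R S ∧ Function.Bijective (galMap R S G act)
/-- The eigenspace `S_ρ = {s ∈ S : σ(s) = ρ·s}` of the generator `σ` of the Galois
group, as an `R`-submodule of `S`. -/
noncomputable def rhoEigenspace (R S : Type*) [CommRing R] [CommRing S] [Algebra R S]
    (ρ : R) (σ : S ≃ₐ[R] S) : Submodule R S :=
  LinearMap.ker (σ.toLinearMap - (LinearMap.mul R S) (algebraMap R S ρ))

/-- The `p`-fold multiplication map `S_ρ ⊗ ⋯ ⊗ S_ρ → S`. -/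
noncomputable def multMap (R S : Type*) [CommRing R] [CommRing S] [Algebra R S]
    (p : ℕ) (ρ : R) (σ : S ≃ₐ[R] S) :
    (⨂[R] _ : Fin p, (rhoEigenspace R S ρ σ)) →ₗ[R] S :=
  PiTensorProduct.lift
    ((MultilinearMap.mkPiAlgebra R (Fin p) S).compLinearMap
      (fun _ => (rhoEigenspace R S ρ σ).subtype))

/-- A finite projective algebra has a linear form whose value at `1` acts as the identity. -/
theorem exists_dual_one_smul_eq (R S : Type*) [CommRing R] [CommRing S] [Algebra R S]
    [Module.Finite R S] [Module.Projective R S] :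
    ∃ f : S →ₗ[R] R, ∀ s : S, f 1 • s = s := by
  obtain ⟨d, hd⟩ := Module.Projective.out (R := R) (P := S)
  let I : Ideal R := LinearMap.range (Module.Dual.eval R S 1)
  have hle : (⊤ : Submodule R S) ≤ I • ⊤ := by
    intro s _
    have h1 : s = (d 1).sum fun m r => r • (m * s) := by
      conv_lhs => rw [← one_mul s, ← hd 1]
      rw [Finsupp.linearCombination_apply, Finsupp.sum, Finsupp.sum, Finset.sum_mul]
      simp
    rw [h1]
    exact Submodule.sum_mem _ fun m _ =>
      Submodule.smul_mem_smul ⟨Finsupp.lapply m ∘ₗ d, rfl⟩ trivial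
  obtain ⟨r, ⟨hr, hr0⟩⟩ := Submodule.exists_sub_one_mem_and_smul_eq_zero_of_fg_of_le_smul
    I ⊤ Module.Finite.fg_top hle
  obtain ⟨f, hf⟩ := hr
  refine ⟨-f, fun s => ?_⟩
  have hf' : f 1 = r - 1 := hf
  rw [LinearMap.neg_apply, hf', neg_sub, sub_smul, one_smul, hr0 s trivial, sub_zero]

section Galois

variable {R S G : Type*} [CommRing R] [CommRing S] [Algebra R S] [Group G]

theorem galMap_tmul (act : G →* (S ≃ₐ[R] S)) (s t : S) (g : G) :
    galMap R S G act (s ⊗ₜ t) g = s * act g t := rfl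

/-- Elements fixed by the Galois group are scalars. -/
theorem IsGaloisExt.smul_one_eq_of_fixed {act : G →* (S ≃ₐ[R] S)} (h : IsGaloisExt R S G act)
    {f : S →ₗ[R] R} (hf : ∀ s : S, f 1 • s = s) {s : S} (hs : ∀ g, act g s = s) :
    f s • (1 : S) = s := by
  have key : s ⊗ₜ[R] (1 : S) = 1 ⊗ₜ s := by
    apply h.2.2.1
    funext g
    simp [galMap_tmul, hs]
  have := congrArg (TensorProduct.lift (LinearMap.lsmul R S ∘ₗ f)) key
  simpa [hf] using this

/-- The coordinate system of a Galois extension. -/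
theorem IsGaloisExt.exists_coordinates [DecidableEq G] {act : G →* (S ≃ₐ[R] S)}
    (h : IsGaloisExt R S G act) :
    ∃ t : Finset (S × S), ∀ g, ∑ i ∈ t, i.1 * act g i.2 = if g = 1 then 1 else 0 := by
  obtain ⟨z, hz⟩ := h.2.2.2 fun g => if g = 1 then 1 else 0
  obtain ⟨t, rfl⟩ := TensorProduct.exists_finset z
  refine ⟨t, fun g => ?_⟩
  rw [← congrFun hz g, map_sum, Finset.sum_apply]
  rfl

theorem act_sum_act [Fintype G] (act : G →* (S ≃ₐ[R] S)) (g : G) (s : S) :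
    act g (∑ k, act k s) = ∑ k, act k s := by
  rw [map_sum]
  exact Fintype.sum_equiv (Equiv.mulLeft g) _ _ fun k => by simp

/-- A Galois extension contains an element of trace one. -/
theorem IsGaloisExt.exists_trace_eq_one [Fintype G] {act : G →* (S ≃ₐ[R] S)}
    (h : IsGaloisExt R S G act) {f : S →ₗ[R] R} (hf : ∀ s : S, f 1 • s = s) :
    ∃ c : S, ∑ g, act g c = 1 := by
  classical
  obtain ⟨t, ht⟩ := h.exists_coordinates
  refine ⟨∑ i ∈ t, f i.1 • i.2, ?_⟩
  have h1 : ∑ i ∈ t, f (∑ g, act g i.2) • i.1 = 1 := by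
    calc _ = ∑ i ∈ t, i.1 * ∑ g, act g i.2 := by
          refine Finset.sum_congr rfl fun i _ => ?_
          conv_rhs => rw [← h.smul_one_eq_of_fixed hf fun g => act_sum_act act g i.2]
          simp
      _ = ∑ g, ∑ i ∈ t, i.1 * act g i.2 := by
          simp_rw [Finset.mul_sum]
          exact Finset.sum_comm
      _ = 1 := by simp [ht]
  calc _ = ∑ i ∈ t, f i.1 • ∑ g, act g i.2 := by
        simp only [map_sum, map_smul, Finset.smul_sum]
        exact Finset.sum_comm
    _ = ∑ i ∈ t, f i.1 • f (∑ g, act g i.2) • (1 : S) := by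
        refine Finset.sum_congr rfl fun i _ => ?_
        rw [h.smul_one_eq_of_fixed hf fun g => act_sum_act act g i.2]
    _ = f (∑ i ∈ t, f (∑ g, act g i.2) • i.1) • (1 : S) := by
        simp only [map_sum _ (fun i : S × S => f (∑ g, act g i.2) • i.1), map_smul, Finset.sum_smul,
          smul_smul, smul_eq_mul]
        exact Finset.sum_congr rfl fun i _ => by rw [mul_comm]
    _ = 1 := by rw [h1, hf]

/-- The submodule on which the Galois group acts through the character `χ`. -/
def charEigenspace (act : G →* (S ≃ₐ[R] S)) (χ : G →* Rˣ) : Submodule R S where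
  carrier := {s | ∀ g, act g s = (χ g : R) • s}
  add_mem' := fun ha hb g => by rw [map_add, ha g, hb g, smul_add]
  zero_mem' := fun g => by simp
  smul_mem' := fun c s hs g => by rw [map_smul, hs g, smul_comm]

theorem mem_charEigenspace {act : G →* (S ≃ₐ[R] S)} {χ : G →* Rˣ} {s : S} :
    s ∈ charEigenspace act χ ↔ ∀ g, act g s = (χ g : R) • s := Iff.rfl

theorem mul_mem_charEigenspace {act : G →* (S ≃ₐ[R] S)} {χ ψ : G →* Rˣ} {s t : S}
    (hs : s ∈ charEigenspace act χ) (ht : t ∈ charEigenspace act ψ) :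
    s * t ∈ charEigenspace act (χ * ψ) := fun g => by
  rw [map_mul, hs g, ht g, smul_mul_smul_comm, MonoidHom.mul_apply, Units.val_mul]

theorem one_mem_charEigenspace (act : G →* (S ≃ₐ[R] S)) :
    (1 : S) ∈ charEigenspace act 1 := fun g => by simp

theorem prod_mem_charEigenspace {act : G →* (S ≃ₐ[R] S)} {χ : G →* Rˣ} {ι : Type*}
    (t : Finset ι) {u : ι → S} (hu : ∀ i ∈ t, u i ∈ charEigenspace act χ) :
    ∏ i ∈ t, u i ∈ charEigenspace act (χ ^ t.card) := by
  classical
  induction t using Finset.induction_on with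
  | empty => exact fun g => by simp
  | insert a t ha ih =>
    have hpow : χ ^ (t.card + 1) = χ * χ ^ t.card := MonoidHom.ext fun g => pow_succ' _ _
    rw [Finset.prod_insert ha, Finset.card_insert_of_notMem ha, hpow]
    exact mul_mem_charEigenspace (hu a (by simp)) (ih fun i hi => hu i (by simp [hi]))

/-- The (unnormalised) projection to an eigenspace lands in it. -/
theorem sum_smul_act_mem_charEigenspace [Fintype G] (act : G →* (S ≃ₐ[R] S)) (χ : G →* Rˣ)
    (s : S) : ∑ k, ((χ k)⁻¹ : Rˣ).val • act k s ∈ charEigenspace act χ := fun g => by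
  rw [map_sum, Finset.smul_sum]
  refine Fintype.sum_equiv (Equiv.mulLeft g) _ _ fun k => ?_
  simp only [Equiv.coe_mulLeft, map_smul, smul_smul, map_mul, AlgEquiv.mul_apply, mul_inv,
    Units.val_mul, Units.mul_inv_cancel_left]

/-- The product of the eigenspaces of opposite characters contains `1`. -/
theorem IsGaloisExt.exists_sum_mul_eq_one [Fintype G] {act : G →* (S ≃ₐ[R] S)}
    (h : IsGaloisExt R S G act) {f : S →ₗ[R] R} (hf : ∀ s : S, f 1 • s = s) (χ : G →* Rˣ) :
    ∃ (t : Finset (S × S)) (a : t → charEigenspace act χ) (b : t → charEigenspace act χ⁻¹),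
      ∑ i, (a i : S) * b i = 1 := by
  classical
  obtain ⟨c, hc⟩ := h.exists_trace_eq_one hf
  obtain ⟨t, ht⟩ := h.exists_coordinates
  refine ⟨t, fun i => ⟨_, sum_smul_act_mem_charEigenspace act χ (c * i.1.1)⟩,
    fun i => ⟨_, sum_smul_act_mem_charEigenspace act χ⁻¹ i.1.2⟩, ?_⟩
  have h1 : ∀ k l : G, ∑ i ∈ t, act k i.1 * act l i.2 = if k = l then 1 else 0 := by
    intro k l
    have := congrArg (act k) (ht (k⁻¹ * l))
    simp only [map_sum, map_mul, AlgEquiv.mul_apply] at this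
    simp only [← AlgEquiv.mul_apply, ← map_mul, mul_inv_cancel_left] at this
    rw [this]
    by_cases hkl : k = l
    · simp [hkl]
    · rw [if_neg hkl, if_neg, map_zero]
      rwa [inv_mul_eq_one]
  rw [Finset.sum_coe_sort t fun i : S × S =>
    (∑ k, ((χ k)⁻¹ : Rˣ).val • act k (c * i.1)) * ∑ l, ((χ⁻¹ l)⁻¹ : Rˣ).val • act l i.2]
  calc _ = ∑ k, ∑ l, (((χ k)⁻¹ : Rˣ).val * (χ l).val) •
        (act k c * ∑ i ∈ t, act k i.1 * act l i.2) := by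
        simp_rw [Finset.sum_mul_sum, Finset.mul_sum, Finset.smul_sum]
        rw [Finset.sum_comm]
        refine Finset.sum_congr rfl fun k _ => ?_
        rw [Finset.sum_comm]
        refine Finset.sum_congr rfl fun l _ => Finset.sum_congr rfl fun i _ => ?_
        rw [smul_mul_smul_comm, map_mul, mul_assoc, MonoidHom.inv_apply, inv_inv]
    _ = 1 := by simp [h1, hc]

section Invertible

variable {act : G →* (S ≃ₐ[R] S)} {χ : G →* Rˣ} {ι : Type*} [Fintype ι]
  {a : ι → charEigenspace act χ} {b : ι → charEigenspace act χ⁻¹}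

theorem IsGaloisExt.map_mul_smul_one (h : IsGaloisExt R S G act)
    {f : S →ₗ[R] R} (hf : ∀ s : S, f 1 • s = s) (v : charEigenspace act χ⁻¹)
    (u : charEigenspace act χ) : f (v * u) • (1 : S) = v * u :=
  h.smul_one_eq_of_fixed hf fun g => by
    simpa using mul_mem_charEigenspace v.2 u.2 g

theorem IsGaloisExt.sum_map_mul_smul (h : IsGaloisExt R S G act)
    {f : S →ₗ[R] R} (hf : ∀ s : S, f 1 • s = s) (hab : ∑ i, (a i : S) * b i = 1)
    (u : charEigenspace act χ) : ∑ i, f (b i * u) • a i = u := by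
  ext
  rw [Submodule.coe_sum]
  calc _ = ∑ i, ((a i : S) * b i) * u := by
        refine Finset.sum_congr rfl fun i _ => ?_
        conv_rhs => rw [mul_assoc, ← h.map_mul_smul_one hf (b i) u, mul_smul_comm, mul_one]
        rfl
    _ = u := by rw [← Finset.sum_mul, hab, one_mul]

theorem IsGaloisExt.projective_finite_charEigenspace (h : IsGaloisExt R S G act)
    {f : S →ₗ[R] R} (hf : ∀ s : S, f 1 • s = s) (hab : ∑ i, (a i : S) * b i = 1) :
    Module.Projective R (charEigenspace act χ) ∧ Module.Finite R (charEigenspace act χ) := by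
  have := h.1
  have := h.2.1
  let q : S →ₗ[R] charEigenspace act χ :=
    ∑ i, (f ∘ₗ LinearMap.mulLeft R (b i : S)).smulRight (a i)
  have hq : ∀ u : charEigenspace act χ, q u = u := fun u => by
    simpa [q] using h.sum_map_mul_smul hf hab u
  exact ⟨Module.Projective.of_split (charEigenspace act χ).subtype q (LinearMap.ext hq),
    Module.Finite.of_surjective q fun u => ⟨u, hq u⟩⟩

theorem charEigenspace_pow_le (h : IsGaloisExt R S G act)
    {f : S →ₗ[R] R} (hf : ∀ s : S, f 1 • s = s) (hab : ∑ i, (a i : S) * b i = 1) (n : ℕ) :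
    charEigenspace act (χ ^ n) ≤ charEigenspace act χ ^ n := by
  induction n with
  | zero =>
    intro s hs
    rw [pow_zero]
    exact Submodule.mem_one.2 ⟨f s, by
      rw [Algebra.algebraMap_eq_smul_one]
      exact h.smul_one_eq_of_fixed hf fun g => by simpa using hs g⟩
  | succ n ih =>
    intro s hs
    have : s = ∑ i, (a i : S) * (b i * s) := by
      simp_rw [← mul_assoc, ← Finset.sum_mul, hab, one_mul]
    rw [this, pow_succ']
    refine Submodule.sum_mem _ fun i _ => Submodule.mul_mem_mul (a i).2 (ih ?_)
    have := mul_mem_charEigenspace (b i).2 hs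
    have hpow : χ⁻¹ * χ ^ (n + 1) = χ ^ n := MonoidHom.ext fun g => by simp [pow_succ']
    rwa [hpow] at this

/-- The multiplication map on the tensor powers of an eigenspace. -/
noncomputable def tensorPowMul (L : Submodule R S) (n : ℕ) : (⨂[R] _ : Fin n, L) →ₗ[R] S :=
  PiTensorProduct.lift
    ((MultilinearMap.mkPiAlgebra R (Fin n) S).compLinearMap fun _ => L.subtype)

theorem tensorPowMul_tprod (L : Submodule R S) (n : ℕ) (u : Fin n → L) :
    tensorPowMul L n (PiTensorProduct.tprod R u) = ∏ j, (u j : S) := by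
  simp [tensorPowMul]

theorem pow_le_range_tensorPowMul (L : Submodule R S) (n : ℕ) :
    L ^ n ≤ LinearMap.range (tensorPowMul L n) := by
  rw [Submodule.pow_eq_span_pow_set, Submodule.span_le]
  intro s hs
  obtain ⟨u, rfl⟩ := Set.mem_pow.1 hs
  exact ⟨PiTensorProduct.tprod R u, by rw [tensorPowMul_tprod, List.prod_ofFn]⟩

theorem IsGaloisExt.map_prod_smul_tprod (h : IsGaloisExt R S G act)
    {f : S →ₗ[R] R} (hf : ∀ s : S, f 1 • s = s) (hab : ∑ i, (a i : S) * b i = 1) {n : ℕ}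
    (hn : n ≠ 0) (hχ : χ ^ n = 1) (u w : Fin n → charEigenspace act χ) :
    f (∏ j, (u j : S)) • PiTensorProduct.tprod R w =
      f (∏ j, (w j : S)) • PiTensorProduct.tprod R u := by
  have hprod : ∀ x : Fin n → charEigenspace act χ,
      f (∏ j, (x j : S)) • (1 : S) = ∏ j, (x j : S) := fun x =>
    h.smul_one_eq_of_fixed hf fun g => by
      simpa [hχ] using prod_mem_charEigenspace Finset.univ (fun j _ => (x j).2) g
  have hexp : ∀ x : Fin n → charEigenspace act χ, PiTensorProduct.tprod R x =
      ∑ r : Fin n → ι, (∏ j, f (b (r j) * x j)) • PiTensorProduct.tprod R fun j => a (r j) := by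
    intro x
    classical
    conv_lhs => rw [← funext fun j => h.sum_map_mul_smul hf hab (x j)]
    rw [MultilinearMap.map_sum]
    exact Finset.sum_congr rfl fun r _ => MultilinearMap.map_smul_univ _ _ _
  have hcongr : ∀ {r r' : R} (x : Fin n → charEigenspace act χ),
      r • (1 : S) = r' • (1 : S) →
      r • PiTensorProduct.tprod R x = r' • PiTensorProduct.tprod R x := by
    intro r r' x hr
    classical
    let j₀ : Fin n := ⟨0, Nat.pos_of_ne_zero hn⟩
    have hr' : r • x j₀ = r' • x j₀ := by
      ext
      simpa using congrArg (· * (x j₀ : S)) hr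
    have := congrArg (fun y => PiTensorProduct.tprod R (Function.update x j₀ y)) hr'
    simpa using this
  rw [hexp w, hexp u, Finset.smul_sum, Finset.smul_sum]
  refine Finset.sum_congr rfl fun r _ => ?_
  rw [smul_smul, smul_smul]
  apply hcongr
  have hcoef : ∀ x y : Fin n → charEigenspace act χ,
      (f (∏ j, (x j : S)) * ∏ j, f (b (r j) * y j)) • (1 : S) =
        (∏ j, (x j : S)) * ((∏ j, (b (r j) : S)) * ∏ j, (y j : S)) := by
    intro x y
    rw [← Finset.prod_mul_distrib]
    conv_rhs => rw [← hprod x]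
    have hvy : (∏ j, (b (r j) * y j : S)) = ∏ j, f (b (r j) * y j) • (1 : S) :=
      Finset.prod_congr rfl fun j _ => (h.map_mul_smul_one hf _ _).symm
    rw [hvy]
    simp only [← Algebra.algebraMap_eq_smul_one, map_mul, map_prod]
  rw [hcoef, hcoef]
  ring

theorem IsGaloisExt.tensorPowMul_injective (h : IsGaloisExt R S G act)
    {f : S →ₗ[R] R} (hf : ∀ s : S, f 1 • s = s) (hab : ∑ i, (a i : S) * b i = 1) {n : ℕ}
    (hn : n ≠ 0) (hχ : χ ^ n = 1) :
    Function.Injective (tensorPowMul (charEigenspace act χ) n) := by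
  let m := tensorPowMul (charEigenspace act χ) n
  have hswap : ∀ x y, f (m x) • y = f (m y) • x := by
    intro x y
    induction x using PiTensorProduct.induction_on with
    | smul_tprod r u =>
      induction y using PiTensorProduct.induction_on with
      | smul_tprod r' w =>
        simp only [m, map_smul, tensorPowMul_tprod, smul_eq_mul, mul_smul]
        rw [smul_comm _ r', h.map_prod_smul_tprod hf hab hn hχ u w, smul_comm r r',
          smul_comm _ r (PiTensorProduct.tprod R u)]
      | add y y' hy hy' => rw [smul_add, hy, hy', map_add, map_add, add_smul]
    | add x x' hx hx' => rw [map_add, map_add, add_smul, hx, hx', smul_add]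
  obtain ⟨t, ht⟩ : (1 : S) ∈ LinearMap.range m := by
    apply pow_le_range_tensorPowMul
    apply charEigenspace_pow_le h hf hab
    rw [hχ]
    exact one_mem_charEigenspace act
  have hone : ∀ x : ⨂[R] _ : Fin n, charEigenspace act χ, f 1 • x = x := by
    intro x
    induction x using PiTensorProduct.induction_on with
    | smul_tprod r u =>
      classical
      let j₀ : Fin n := ⟨0, Nat.pos_of_ne_zero hn⟩
      have hu : f 1 • u j₀ = u j₀ := Subtype.ext (hf _)
      have := congrArg (fun y => PiTensorProduct.tprod R (Function.update u j₀ y)) hu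
      rw [smul_comm]
      congr 1
      simpa using this
    | add x x' hx hx' => rw [smul_add, hx, hx']
  intro x y hxy
  have hx := hswap x t
  have hy := hswap y t
  rw [ht, hone] at hx hy
  rw [← hx, ← hy]
  exact congrArg (fun s => f s • t) hxy

theorem IsGaloisExt.range_tensorPowMul (h : IsGaloisExt R S G act)
    {f : S →ₗ[R] R} (hf : ∀ s : S, f 1 • s = s) (hab : ∑ i, (a i : S) * b i = 1) {n : ℕ}
    (hχ : χ ^ n = 1) :
    LinearMap.range (tensorPowMul (charEigenspace act χ) n) =
      LinearMap.range (Algebra.linearMap R S) := by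
  apply le_antisymm
  · rintro _ ⟨x, rfl⟩
    induction x using PiTensorProduct.induction_on with
    | smul_tprod r u =>
      rw [map_smul, tensorPowMul_tprod]
      refine Submodule.smul_mem _ _ ⟨f (∏ j, (u j : S)), ?_⟩
      rw [Algebra.linearMap_apply, Algebra.algebraMap_eq_smul_one]
      exact h.smul_one_eq_of_fixed hf fun g => by
        simpa [hχ] using prod_mem_charEigenspace Finset.univ (fun j _ => (u j).2) g
    | add x y hx hy => rw [map_add]; exact Submodule.add_mem _ hx hy
  · rintro _ ⟨r, rfl⟩
    rw [Algebra.linearMap_apply, Algebra.algebraMap_eq_smul_one]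
    refine Submodule.smul_mem _ _ (pow_le_range_tensorPowMul _ _
      (charEigenspace_pow_le h hf hab n ?_))
    rw [hχ]
    exact one_mem_charEigenspace act

end Invertible

end Galois

/-- For a cyclic group, the eigenspace of a generator is the eigenspace of a character. -/
theorem exists_rhoEigenspace_eq_charEigenspace {p : ℕ} [NeZero p] {R S : Type*} [CommRing R]
    [CommRing S] [Algebra R S] {ρ : R} (hρ : ρ ^ p = 1)
    (act : Multiplicative (ZMod p) →* (S ≃ₐ[R] S)) :
    ∃ χ : Multiplicative (ZMod p) →* Rˣ, χ ^ p = 1 ∧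
      rhoEigenspace R S ρ (act (Multiplicative.ofAdd 1)) = charEigenspace act χ := by
  let χ : Multiplicative (ZMod p) →* Rˣ := (AddChar.zmodChar p hρ).toMonoidHom.toHomUnits
  have hval : ∀ g, (χ g : R) = ρ ^ (Multiplicative.toAdd g).val := fun g =>
    AddChar.zmodChar_apply hρ _
  have hgen : (χ (Multiplicative.ofAdd 1) : R) = ρ := by
    have := AddChar.zmodChar_apply' hρ 1
    rw [Nat.cast_one, pow_one] at this
    exact this
  refine ⟨χ, ?_, ?_⟩
  · refine MonoidHom.ext fun g => Units.ext ?_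
    rw [MonoidHom.pow_apply, Units.val_pow_eq_pow_val, hval, pow_right_comm, hρ, one_pow]
    rfl
  · ext s
    have hmem : s ∈ rhoEigenspace R S ρ (act (Multiplicative.ofAdd 1)) ↔
        act (Multiplicative.ofAdd 1) s = ρ • s := by
      simp [rhoEigenspace, sub_eq_zero, Algebra.smul_def]
    rw [hmem, mem_charEigenspace]
    refine ⟨fun hs g => ?_, fun hs => by simpa [hgen] using hs (Multiplicative.ofAdd 1)⟩
    have hpow : ∀ n : ℕ, act (Multiplicative.ofAdd 1 ^ n) s = ρ ^ n • s := by
      intro n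
      induction n with
      | zero => simp
      | succ n ih =>
        rw [pow_succ, map_mul, AlgEquiv.mul_apply, hs, map_smul, ih, smul_smul, pow_succ']
    have hg : g = Multiplicative.ofAdd 1 ^ (Multiplicative.toAdd g).val := by
      rw [← ofAdd_nsmul]
      simp
    rw [hval, ← hpow, ← hg]

theorem stmt18 (p : ℕ) (hp : p.Prime)
    (R S : Type*) [CommRing R] [CommRing S] [Algebra R S]
    (ρ : R) (hρ : IsPrimitiveRoot ρ p)
    (act : Multiplicative (ZMod p) →* (S ≃ₐ[R] S))
    (hgal : IsGaloisExt R S (Multiplicative (ZMod p)) act) :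
    Module.Projective R (rhoEigenspace R S ρ (act (Multiplicative.ofAdd 1))) ∧
    Module.Finite R (rhoEigenspace R S ρ (act (Multiplicative.ofAdd 1))) ∧
    Function.Injective (multMap R S p ρ (act (Multiplicative.ofAdd 1))) ∧
    LinearMap.range (multMap R S p ρ (act (Multiplicative.ofAdd 1))) =
      LinearMap.range (Algebra.linearMap R S) := by
  have : NeZero p := ⟨hp.ne_zero⟩
  have := hgal.1
  have := hgal.2.1
  obtain ⟨f, hf⟩ := exists_dual_one_smul_eq R S
  obtain ⟨χ, hχ, hL⟩ := exists_rhoEigenspace_eq_charEigenspace hρ.pow_eq_one act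
  obtain ⟨t, a, b, hab⟩ := hgal.exists_sum_mul_eq_one hf χ
  change _ ∧ _ ∧ Function.Injective (tensorPowMul (rhoEigenspace R S ρ _) p) ∧
    LinearMap.range (tensorPowMul (rhoEigenspace R S ρ _) p) = _
  rw [hL]
  obtain ⟨hproj, hfin⟩ := hgal.projective_finite_charEigenspace hf hab
  exact ⟨hproj, hfin, hgal.tensorPowMul_injective hf hab hp.ne_zero hχ,
    hgal.range_tensorPowMul hf hab hχ⟩
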